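/- Let k be a field of characteristic zero, let R = k[x₁, x₂, x₃, x₄, y₁₂, y₁₃, y₁₄, y₂₃, y₂₄, y₃₄], and let I ⊂ R be the ideal generated by the five quadrics y₁₂y₃₄ − y₁₃y₂₄ + y₁₄y₂₃, x₂y₁₂ − x₃y₁₃ + x₄y₁₄, x₁y₁₂ − x₃y₂₃ + x₄y₂₄, x₁y₁₃ − x₂y₂₃ + x₄y₃₄, x₁y₁₄ − x₂y₂₄ + x₃y₃₄. Then I is a prime ideal; equivalently, the quotient ring R/I is an integral domain. -/

import Mathlib

open MvPolynomial

/-- The polynomial ring `k[x₁, x₂, x₃, x₄, y₁₂, y₁₃, y₁₄, y₂₃, y₂₄, y₃₄]`,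
with variables indexed by `Fin 10` in the order
`x₁, x₂, x₃, x₄, y₁₂, y₁₃, y₁₄, y₂₃, y₂₄, y₃₄`. -/
abbrev CoxRing5Ambient (k : Type*) [Field k] := MvPolynomial (Fin 10) k

/-- The ideal generated by the five quadrics
`y₁₂y₃₄ − y₁₃y₂₄ + y₁₄y₂₃`, `x₂y₁₂ − x₃y₁₃ + x₄y₁₄`, `x₁y₁₂ − x₃y₂₃ + x₄y₂₄`,
`x₁y₁₃ − x₂y₂₃ + x₄y₃₄`, `x₁y₁₄ − x₂y₂₄ + x₃y₃₄` (the 4×4 Pfaffians of the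
skew-symmetric matrix `M` with `M₀₁ = x₁, M₀₂ = x₂, M₀₃ = x₃, M₀₄ = x₄,
M₁₂ = y₃₄, M₁₃ = y₂₄, M₁₄ = y₂₃, M₂₃ = y₁₄, M₂₄ = y₁₃, M₃₄ = y₁₂`). -/
noncomputable def coxIdeal5 (k : Type*) [Field k] : Ideal (CoxRing5Ambient k) :=
  Ideal.span
    {X 4 * X 9 - X 5 * X 8 + X 6 * X 7,
     X 1 * X 4 - X 2 * X 5 + X 3 * X 6,
     X 0 * X 4 - X 2 * X 7 + X 3 * X 8,
     X 0 * X 5 - X 1 * X 7 + X 3 * X 9,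
     X 0 * X 6 - X 1 * X 8 + X 2 * X 9}

namespace MonomialOrder

variable {σ τ R : Type*} [CommRing R]

theorem degree_finset_prod_pow [IsDomain R] (m : MonomialOrder τ) {p : σ → MvPolynomial τ R}
    (hp : ∀ i, p i ≠ 0) (s : σ →₀ ℕ) :
    m.degree (s.prod fun i n => p i ^ n) = s.sum fun i n => n • m.degree (p i) := by
  rw [Finsupp.prod, m.degree_prod fun i _ => pow_ne_zero _ (hp i)]
  exact Finset.sum_congr rfl fun i _ => m.degree_pow _ _

/-- If the leading exponents of the images of the monomials supporting `f` are distinct, then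
`f` is not in the kernel of the substitution `X i ↦ p i`. -/
theorem eq_zero_of_aeval_eq_zero [IsDomain R] (m : MonomialOrder τ) {p : σ → MvPolynomial τ R}
    (hp : ∀ i, p i ≠ 0) {f : MvPolynomial σ R}
    (hinj : Set.InjOn (fun s : σ →₀ ℕ => s.sum fun i n => n • m.degree (p i)) f.support)
    (hf : aeval p f = 0) : f = 0 := by
  classical
  by_contra hne
  obtain ⟨s, hs, hmax⟩ := f.support.exists_max_image
    (fun s => m.toSyn (s.sum fun i n => n • m.degree (p i))) (support_nonempty.mpr hne)
  set q : (σ →₀ ℕ) → MvPolynomial τ R := fun t => t.prod fun i n => p i ^ n with hq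
  have hdeg (t : σ →₀ ℕ) : m.degree (q t) = t.sum fun i n => n • m.degree (p i) :=
    m.degree_finset_prod_pow hp t
  have hcoeff : (aeval p f).coeff (m.degree (q s)) = f.coeff s * m.leadingCoeff (q s) := by
    rw [aeval_def, eval₂_eq, coeff_sum, Finset.sum_eq_single s]
    · rw [algebraMap_eq, coeff_C_mul]
      rfl
    · intro t ht hts
      rw [algebraMap_eq, coeff_C_mul]
      refine mul_eq_zero_of_right _ (m.coeff_eq_zero_of_lt (f := q t) ?_)
      rw [hdeg, hdeg]
      exact lt_of_le_of_ne (hmax t ht) fun h => hts (hinj ht hs (m.toSyn.injective h))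
    · exact fun h => absurd hs h
  rw [hf, coeff_zero] at hcoeff
  refine mul_ne_zero (mem_support_iff.mp hs) (m.leadingCoeff_ne_zero_iff.mpr ?_) hcoeff.symm
  exact Finset.prod_ne_zero_iff.mpr fun i _ => pow_ne_zero _ (hp i)

theorem degree_lex_mul_sub_mul [Nontrivial R] [LinearOrder σ] [WellFoundedGT σ] {a b c d : σ}
    (hab : a < b) (hac : a < c) (had : a < d) :
    MonomialOrder.lex.degree (X a * X b - X c * X d : MvPolynomial σ R) =
      Finsupp.single a 1 + Finsupp.single b 1 := by
  classical
  have hX (i j : σ) : (X i * X j : MvPolynomial σ R) =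
      monomial (Finsupp.single i 1 + Finsupp.single j 1) 1 := by
    rw [X, X, monomial_mul, one_mul]
  have hd (i j : σ) : MonomialOrder.lex.degree (X i * X j : MvPolynomial σ R) =
      Finsupp.single i 1 + Finsupp.single j 1 := by
    rw [hX, degree_monomial, if_neg one_ne_zero]
  rw [degree_sub_of_lt, hd]
  rw [hd, hd, lex_lt_iff, Finsupp.Lex.lt_iff]
  refine ⟨a, fun j hj => ?_, ?_⟩
  · simp [hj.ne', (hj.trans hab).ne', (hj.trans hac).ne', (hj.trans had).ne']
  · simp [Finsupp.single_apply, hac.ne', had.ne']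

end MonomialOrder

namespace MvPolynomial

variable {σ R : Type*} [CommRing R]

/-- A rewriting rule `X a * X b ↦ X c * X d - X e * X f` modulo `I` which decreases the weight
reduces every monomial divisible by `X a * X b`. -/
theorem monomial_mem_of_rewrite {I : Ideal (MvPolynomial σ R)}
    {T : Submodule R (MvPolynomial σ R)} (hIT : I.restrictScalars R ≤ T) (w : σ → ℕ)
    {s : σ →₀ ℕ}
    (ih : ∀ t, Finsupp.weight w t < Finsupp.weight w s → monomial t (1 : R) ∈ T)
    {a b c d e f : σ}
    (hI : X a * X b - X c * X d + X e * X f ∈ I)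
    (hcd : w c + w d < w a + w b) (hef : w e + w f < w a + w b)
    (hab : a ≠ b) (ha : s a ≠ 0) (hb : s b ≠ 0) : monomial s (1 : R) ∈ T := by
  classical
  have hX (i j : σ) : (X i * X j : MvPolynomial σ R) =
      monomial (Finsupp.single i 1 + Finsupp.single j 1) 1 := by
    rw [X, X, monomial_mul, one_mul]
  have hw (i j : σ) : Finsupp.weight w (Finsupp.single i 1 + Finsupp.single j 1) = w i + w j := by
    simp [Finsupp.weight_single]
  obtain ⟨t, rfl⟩ : ∃ t, s = t + (Finsupp.single a 1 + Finsupp.single b 1) := by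
    refine ⟨s - (Finsupp.single a 1 + Finsupp.single b 1), (tsub_add_cancel_of_le ?_).symm⟩
    intro i
    by_cases hia : a = i <;> by_cases hib : b = i <;>
      simp_all [Nat.one_le_iff_ne_zero]
  have key : monomial (t + (Finsupp.single a 1 + Finsupp.single b 1)) (1 : R) =
      monomial t 1 * (X a * X b - X c * X d + X e * X f) +
        (monomial (t + (Finsupp.single c 1 + Finsupp.single d 1)) 1 -
          monomial (t + (Finsupp.single e 1 + Finsupp.single f 1)) 1) := by
    have hmul (q : σ →₀ ℕ) : monomial (t + q) (1 : R) = monomial t 1 * monomial q 1 := by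
      rw [monomial_mul, one_mul]
    simp only [hX, hmul]
    ring
  rw [key]
  refine T.add_mem (hIT (I.mul_mem_left _ hI))
    (T.sub_mem (ih _ ?_) (ih _ ?_))
  all_goals
    rw [map_add _ t, map_add _ t, hw, hw]
    omega

end MvPolynomial

/-- Exponents of the monomials avoiding the leading terms `x₁y₁₂`, `x₁y₁₃`, `x₁y₁₄`, `x₂y₁₂`,
`y₁₄y₂₃` of the five quadrics. -/
def coxStandard5 : Set (Fin 10 →₀ ℕ) :=
  {s | (s 0 = 0 ∨ s 4 = 0) ∧ (s 0 = 0 ∨ s 5 = 0) ∧ (s 0 = 0 ∨ s 6 = 0) ∧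
    (s 1 = 0 ∨ s 4 = 0) ∧ (s 6 = 0 ∨ s 7 = 0)}

/-- A weight for which the leading terms of the five quadrics are the ones excluded in
`coxStandard5`. -/
def coxWeight5 : Fin 10 → ℕ :=
  ![1, 1, 1, 0, 3, 2, 3, 1, 1, 0]

/-- Standard monomials span the quotient by `coxIdeal5`. -/
theorem coxIdeal5_sup_restrictSupport (k : Type*) [Field k] :
    (coxIdeal5 k).restrictScalars k ⊔ restrictSupport k coxStandard5 = ⊤ := by
  set T := (coxIdeal5 k).restrictScalars k ⊔ restrictSupport k coxStandard5
  have hIT : (coxIdeal5 k).restrictScalars k ≤ T := le_sup_left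
  have hmono (n : ℕ) : ∀ s, Finsupp.weight coxWeight5 s = n →
      monomial s (1 : k) ∈ T := by
    induction n using Nat.strong_induction_on with
    | _ n IH =>
      rintro s rfl
      have ih := fun t ht => IH _ ht t rfl
      by_cases h04 : s 0 = 0 ∨ s 4 = 0
      swap
      · push Not at h04
        refine monomial_mem_of_rewrite hIT _ ih (c := 2) (d := 7) (e := 3) (f := 8)
          ?_ (by decide) (by decide) (by decide) h04.1 h04.2
        exact Ideal.subset_span (by simp)
      by_cases h05 : s 0 = 0 ∨ s 5 = 0
      swap
      · push Not at h05
        refine monomial_mem_of_rewrite hIT _ ih (c := 1) (d := 7) (e := 3) (f := 9)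
          ?_ (by decide) (by decide) (by decide) h05.1 h05.2
        exact Ideal.subset_span (by simp)
      by_cases h06 : s 0 = 0 ∨ s 6 = 0
      swap
      · push Not at h06
        refine monomial_mem_of_rewrite hIT _ ih (c := 1) (d := 8) (e := 2) (f := 9)
          ?_ (by decide) (by decide) (by decide) h06.1 h06.2
        exact Ideal.subset_span (by simp)
      by_cases h14 : s 1 = 0 ∨ s 4 = 0
      swap
      · push Not at h14
        refine monomial_mem_of_rewrite hIT _ ih (c := 2) (d := 5) (e := 3) (f := 6)
          ?_ (by decide) (by decide) (by decide) h14.1 h14.2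
        exact Ideal.subset_span (by simp)
      by_cases h67 : s 6 = 0 ∨ s 7 = 0
      swap
      · push Not at h67
        refine monomial_mem_of_rewrite hIT _ ih (c := 5) (d := 8) (e := 4) (f := 9)
          ?_ (by decide) (by decide) (by decide) h67.1 h67.2
        rw [sub_add_comm]
        exact Ideal.subset_span (by simp)
      exact le_sup_right (a := (coxIdeal5 k).restrictScalars k)
        ((monomial_mem_restrictSupport k).mpr (Or.inl ⟨h04, h05, h06, h14, h67⟩))
  rw [eq_top_iff]
  rintro f -
  rw [f.as_sum]
  refine T.sum_mem fun s _ => ?_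
  rw [← mul_one (coeff s f), ← smul_eq_mul, ← smul_monomial]
  exact T.smul_mem _ (hmono _ s rfl)

/-- The parametrization of the affine cone over `Gr(2, 5)` on the chart `x₁ ≠ 0`, in the variables
`z₂₃, z₂₄, z₃₄, x₁, x₂, x₃, x₄`. -/
noncomputable def coxParam5 (k : Type*) [Field k] : Fin 10 → MvPolynomial (Fin 7) k :=
  ![X 3, X 4, X 5, X 6, X 0 * X 5 - X 1 * X 6, X 0 * X 4 - X 2 * X 6, X 1 * X 4 - X 2 * X 5,
    X 3 * X 0, X 3 * X 1, X 3 * X 2]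

theorem coxIdeal5_le_ker (k : Type*) [Field k] :
    coxIdeal5 k ≤ RingHom.ker (aeval (R := k) (coxParam5 k)) := by
  rw [coxIdeal5, Ideal.span_le]
  rintro f (rfl | rfl | rfl | rfl | rfl) <;>
  · simp only [SetLike.mem_coe, RingHom.mem_ker, map_add, map_sub, map_mul, aeval_X, coxParam5,
      Matrix.cons_val]
    ring

/-- The leading exponents of `coxParam5` in the lexicographic order. -/
noncomputable def coxLeading5 : Fin 10 → Fin 7 →₀ ℕ :=
  ![Finsupp.single 3 1, Finsupp.single 4 1, Finsupp.single 5 1, Finsupp.single 6 1,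
      Finsupp.single 0 1 + Finsupp.single 5 1, Finsupp.single 0 1 + Finsupp.single 4 1,
      Finsupp.single 1 1 + Finsupp.single 4 1, Finsupp.single 3 1 + Finsupp.single 0 1,
      Finsupp.single 3 1 + Finsupp.single 1 1, Finsupp.single 3 1 + Finsupp.single 2 1]

theorem degree_coxParam5 (k : Type*) [Field k] (i : Fin 10) :
    MonomialOrder.lex.degree (coxParam5 k i) = coxLeading5 i := by
  have hX (a b : Fin 7) : MonomialOrder.lex.degree (X a * X b : MvPolynomial (Fin 7) k) =
      Finsupp.single a 1 + Finsupp.single b 1 := by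
    rw [MonomialOrder.degree_mul (X_ne_zero a) (X_ne_zero b), MonomialOrder.degree_X,
      MonomialOrder.degree_X]
  have hXX {a b c d : Fin 7} (hab : a < b) (hac : a < c) (had : a < d) :=
    MonomialOrder.degree_lex_mul_sub_mul (R := k) hab hac had
  fin_cases i
  exacts [MonomialOrder.degree_X, MonomialOrder.degree_X, MonomialOrder.degree_X,
    MonomialOrder.degree_X, hXX (by decide) (by decide) (by decide),
    hXX (by decide) (by decide) (by decide), hXX (by decide) (by decide) (by decide),
    hX _ _, hX _ _, hX _ _]

theorem injOn_coxStandard5 :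
    Set.InjOn (fun s : Fin 10 →₀ ℕ => s.sum fun i n => n • coxLeading5 i) coxStandard5 := by
  rintro s ⟨hs1, hs2, hs3, hs4, hs5⟩ t ⟨ht1, ht2, ht3, ht4, ht5⟩ h
  have h' (j : Fin 7) := DFunLike.congr_fun h j
  simp [coxLeading5, Finsupp.sum_fintype, Fin.sum_univ_succ, Fin.forall_fin_succ,
    Finsupp.single_apply] at h'
  obtain ⟨h0, h1, h2, h3, h4, h5, h6⟩ := h'
  have e0 : s 0 = t 0 := by omega
  have e456 : s 4 + s 5 + s 6 = t 4 + t 5 + t 6 := by omega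
  have e6 : s 6 = t 6 := by omega
  have e7 : s 7 = t 7 := by omega
  have e4 : s 4 = t 4 := by omega
  have e5 : s 5 = t 5 := by omega
  have e1 : s 1 = t 1 := by omega
  have e2 : s 2 = t 2 := by omega
  have e8 : s 8 = t 8 := by omega
  ext i
  fin_cases i
  exacts [e0, e1, e2, h6, e4, e5, e6, e7, e8, h2]

/-- The ideal of Pfaffian quadrics defining the Cox ring of the degree-5 del
Pezzo surface is prime; equivalently `R/I` is an integral domain. -/
theorem coxIdeal5_isPrime (k : Type*) [Field k] [CharZero k] :
    (coxIdeal5 k).IsPrime := by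
  have hp (i : Fin 10) : coxParam5 k i ≠ 0 := fun h => by
    have := degree_coxParam5 k i
    rw [h, MonomialOrder.degree_zero] at this
    fin_cases i <;> simp [coxLeading5, Finsupp.ext_iff, Fin.forall_fin_succ] at this
  suffices coxIdeal5 k = RingHom.ker (aeval (R := k) (coxParam5 k)) from
    this ▸ RingHom.ker_isPrime _
  refine le_antisymm (coxIdeal5_le_ker k) fun f hf => ?_
  obtain ⟨g, hg, r, hr, rfl⟩ := Submodule.mem_sup.mp
    (coxIdeal5_sup_restrictSupport k ▸ Submodule.mem_top (x := f))
  have hg' : g ∈ coxIdeal5 k := hg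
  have hker := coxIdeal5_le_ker k hg'
  rw [RingHom.mem_ker] at hf hker
  rw [map_add, hker, zero_add] at hf
  have hr0 : r = 0 := by
    refine MonomialOrder.lex.eq_zero_of_aeval_eq_zero hp ?_ hf
    simp only [degree_coxParam5]
    exact injOn_coxStandard5.mono ((mem_restrictSupport_iff k).mp hr)
  rwa [hr0, add_zero]
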